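/- arXiv:2403.04266 — 9 statements merged into one kernel-verified Lean document; each statement's English description precedes it below -/
import Mathlib

section
/- Let R be a finite commutative ring with unity that is not local, and write R ≅ R1 × R2 × ⋯ × Rn (n ≥ 2) as a product of finite local rings (Ri, Mi). Then the upper ideal relation graph Γ_U(R) is a cograph if and only if n = 2 and both maximal ideals M1 and M2 are principal ideals. -/
/-- The upper ideal relation graph of a commutative ring `R` with unity: vertices are the
non-unit elements of `R`, and distinct vertices `x, y` are adjacent iff there is a non-unit
`z` with `(x) ⊆ (z)` and `(y) ⊆ (z)`. -/
def upperIdealRelGraph (R : Type*) [CommRing R] : SimpleGraph {x : R // ¬ IsUnit x} where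
  Adj x y := x ≠ y ∧ ∃ z : R, ¬ IsUnit z ∧
      Ideal.span {(x : R)} ≤ Ideal.span {z} ∧ Ideal.span {(y : R)} ≤ Ideal.span {z}
  symm := by
    constructor
    rintro x y ⟨hxy, z, hz, h1, h2⟩
    exact ⟨hxy.symm, z, hz, h2, h1⟩
  loopless := by
    constructor
    rintro x ⟨h, -⟩
    exact h rfl

/-- `G` has an induced path on four vertices `a ~ b ~ c ~ d`. -/
def SimpleGraph.HasInducedP4 {V : Type*} (G : SimpleGraph V) : Prop :=
  ∃ a b c d : V, a ≠ b ∧ a ≠ c ∧ a ≠ d ∧ b ≠ c ∧ b ≠ d ∧ c ≠ d ∧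
    G.Adj a b ∧ G.Adj b c ∧ G.Adj c d ∧ ¬ G.Adj a c ∧ ¬ G.Adj a d ∧ ¬ G.Adj b d

/-- A cograph is a graph with no induced `P₄`. -/
def SimpleGraph.IsCograph {V : Type*} (G : SimpleGraph V) : Prop :=
  ¬ G.HasInducedP4

/-- `x` and `y` have a common nonunit divisor. -/
def UIRcd {P : Type*} [CommRing P] (x y : P) : Prop := ∃ z : P, ¬ IsUnit z ∧ z ∣ x ∧ z ∣ y

theorem UIRcd_map {P Q : Type*} [CommRing P] [CommRing Q] (e : P ≃+* Q) (x y : P) :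
    UIRcd (e x) (e y) ↔ UIRcd x y := by
  constructor
  · rintro ⟨z, hz, h1, h2⟩
    refine ⟨e.symm z, fun h => hz ?_, ?_, ?_⟩
    · simpa using h.map e
    · simpa using map_dvd e.symm h1
    · simpa using map_dvd e.symm h2
  · rintro ⟨z, hz, h1, h2⟩
    refine ⟨e z, fun h => hz ?_, map_dvd e h1, map_dvd e h2⟩
    simpa using h.map e.symm

theorem UIR_adj {R : Type*} [CommRing R] (x y : {x : R // ¬ IsUnit x}) :
    (upperIdealRelGraph R).Adj x y ↔ x ≠ y ∧ UIRcd (x : R) y := by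
  simp only [upperIdealRelGraph, UIRcd, Ideal.span_singleton_le_span_singleton]

theorem UIR_P4 {R Q : Type*} [CommRing R] [CommRing Q] (e : R ≃+* Q) :
    (upperIdealRelGraph R).HasInducedP4 ↔ ∃ a b c d : Q,
      UIRcd a b ∧ UIRcd b c ∧ UIRcd c d ∧ ¬ UIRcd a c ∧ ¬ UIRcd a d ∧ ¬ UIRcd b d := by
  constructor
  · rintro ⟨a, b, c, d, h1, h2, h3, h4, h5, h6, h⟩
    simp only [UIR_adj] at h
    refine ⟨e a, e b, e c, e d, ?_⟩
    simp only [UIRcd_map]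
    tauto
  · rintro ⟨a, b, c, d, h⟩
    obtain ⟨a, rfl⟩ := e.surjective a
    obtain ⟨b, rfl⟩ := e.surjective b
    obtain ⟨c, rfl⟩ := e.surjective c
    obtain ⟨d, rfl⟩ := e.surjective d
    simp only [UIRcd_map] at h
    obtain ⟨h1, h2, h3, h4, h5, h6⟩ := h
    have nl : ∀ {x y : R}, UIRcd x y → ¬ IsUnit x := by
      rintro x y ⟨z, hz, hx, -⟩ hu
      exact hz (isUnit_of_dvd_unit hx hu)
    have nr : ∀ {x y : R}, UIRcd x y → ¬ IsUnit y := by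
      rintro x y ⟨z, hz, -, hx⟩ hu
      exact hz (isUnit_of_dvd_unit hx hu)
    have sl : ∀ {x : R}, ¬ IsUnit x → UIRcd x x := fun h => ⟨_, h, dvd_rfl, dvd_rfl⟩
    have ab : a ≠ b := by rintro rfl; exact h4 h2
    have ac : a ≠ c := by rintro rfl; exact h4 (sl (nl h1))
    have ad : a ≠ d := by rintro rfl; exact h5 (sl (nl h1))
    have bc : b ≠ c := by rintro rfl; exact h4 h1
    have bd : b ≠ d := by rintro rfl; exact h6 (sl (nl h2))
    have cd : c ≠ d := by rintro rfl; exact h6 h2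
    refine ⟨⟨a, nl h1⟩, ⟨b, nl h2⟩, ⟨c, nl h3⟩, ⟨d, nr h3⟩, ?_⟩
    simp only [UIR_adj, ne_eq, Subtype.mk.injEq]
    tauto

theorem UIR_not {ι : Type*} {S : ι → Type*} [∀ i, CommRing (S i)] {x y : ∀ i, S i}
    (h : ∀ i, ∀ w : S i, w ∣ x i → w ∣ y i → IsUnit w) : ¬ UIRcd x y := by
  rintro ⟨z, hz, h1, h2⟩
  exact hz (Pi.isUnit_iff.2 fun i => h i _ (pi_dvd_iff.1 h1 i) (pi_dvd_iff.1 h2 i))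

theorem UIR_yes {ι : Type*} {S : ι → Type*} [∀ i, CommRing (S i)] {x y : ∀ i, S i}
    (i : ι) (w : S i) (hw : ¬ IsUnit w) (h1 : w ∣ x i) (h2 : w ∣ y i) : UIRcd x y := by
  classical
  refine ⟨Function.update 1 i w, fun h => hw ?_, ?_, ?_⟩
  · simpa using Pi.isUnit_iff.1 h i
  all_goals
    rw [pi_dvd_iff]
    intro j
    by_cases hj : j = i
    · subst hj; simpa
    · simp [hj]

theorem UIR_pair {A : Type*} [CommRing A] [Finite A] [IsLocalRing A]
    (h : ¬ (IsLocalRing.maximalIdeal A).IsPrincipal) :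
    ∃ x y : A, ¬ IsUnit x ∧ ¬ IsUnit y ∧ ∀ w, w ∣ x → w ∣ y → IsUnit w := by
  by_contra! H
  obtain ⟨I, ⟨z, hz, rfl⟩, hmax⟩ := (wellFounded_gt (α := Ideal A)).has_min
    {I : Ideal A | ∃ z, ¬ IsUnit z ∧ I = Ideal.span {z}} ⟨_, 0, not_isUnit_zero, rfl⟩
  apply h
  refine ⟨z, le_antisymm ?_ ?_⟩
  · intro y hy
    obtain ⟨w, hwz, hwy, hw⟩ := H z y hz ((IsLocalRing.mem_maximalIdeal y).1 hy)
    have h1 := hmax (Ideal.span {w}) ⟨w, hw, rfl⟩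
    have h2 : Ideal.span {z} ≤ Ideal.span {w} := Ideal.span_singleton_le_span_singleton.2 hwz
    have h3 : Ideal.span {z} = Ideal.span {w} := by
      by_contra hne
      exact h1 (lt_of_le_of_ne h2 hne)
    change y ∈ Ideal.span {z}
    rw [h3]
    exact Ideal.mem_span_singleton.2 hwy
  · change Ideal.span {z} ≤ _
    rw [Ideal.span_singleton_le_iff_mem]
    exact (IsLocalRing.mem_maximalIdeal z).2 hz

theorem upperIdealRelGraph_isCograph_iff (R : Type*) [CommRing R] [Fintype R]
    (hR : ¬ IsLocalRing R) {n : ℕ} (hn : 2 ≤ n) (Rs : Fin n → Type*)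
    [∀ i, CommRing (Rs i)] [∀ i, Fintype (Rs i)] [∀ i, IsLocalRing (Rs i)]
    (e : R ≃+* ∀ i, Rs i) :
    (upperIdealRelGraph R).IsCograph ↔
      (n = 2 ∧ ∀ i, (IsLocalRing.maximalIdeal (Rs i)).IsPrincipal) := by
  unfold SimpleGraph.IsCograph
  rw [UIR_P4 e]
  constructor
  · intro H
    constructor
    · by_contra hne
      apply H
      let f : Finset (Fin n) → ∀ i, Rs i := fun s i => if i ∈ s then 0 else 1
      have hy : ∀ s t (i : Fin n), i ∈ s → i ∈ t → UIRcd (f s) (f t) := by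
        intro s t i hs ht
        exact UIR_yes i 0 not_isUnit_zero (by simp [f, hs]) (by simp [f, ht])
      have hno : ∀ s t, Disjoint s t → ¬ UIRcd (f s) (f t) := by
        intro s t hst
        apply UIR_not
        intro i w h1 h2
        by_cases hs : i ∈ s
        · have ht := Finset.disjoint_left.1 hst hs
          simp only [f, ht, if_false] at h2
          exact isUnit_of_dvd_one h2
        · simp only [f, hs, if_false] at h1
          exact isUnit_of_dvd_one h1
      let i0 : Fin n := ⟨0, by omega⟩
      let i1 : Fin n := ⟨1, by omega⟩
      let i2 : Fin n := ⟨2, by omega⟩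
      refine ⟨f {i0}, f {i0, i1}, f {i1, i2}, f {i2}, hy _ _ i0 ?_ ?_, hy _ _ i1 ?_ ?_,
        hy _ _ i2 ?_ ?_, hno _ _ ?_, hno _ _ ?_, hno _ _ ?_⟩ <;> simp [i0, i1, i2]
    · intro i
      by_contra hp
      apply H
      obtain ⟨x, y, hx, hy, hxy⟩ := UIR_pair hp
      have : Nontrivial (Fin n) := Fin.nontrivial_iff_two_le.2 hn
      obtain ⟨j, hj⟩ := exists_ne i
      have hno : ∀ u v : ∀ k, Rs k, (u = 1 ∨ v = 1) →
          ¬ UIRcd (Function.update u i x) (Function.update v i y) := by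
        intro u v huv
        apply UIR_not
        intro k w h1 h2
        by_cases hk : k = i
        · subst hk
          simp only [Function.update_self] at h1 h2
          exact hxy w h1 h2
        · simp only [ne_eq, hk, not_false_eq_true, Function.update_of_ne] at h1 h2
          rcases huv with rfl | rfl
          · exact isUnit_of_dvd_one h1
          · exact isUnit_of_dvd_one h2
      refine ⟨Function.update 1 i x, Function.update 0 i x, Function.update 0 i y,
        Function.update 1 i y, UIR_yes i x hx ?_ ?_, UIR_yes j 0 not_isUnit_zero ?_ ?_,
        UIR_yes i y hy ?_ ?_, hno _ _ ?_, hno _ _ ?_, hno _ _ ?_⟩ <;> simp [hj]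
  · rintro ⟨rfl, hp⟩
    have key : ∀ x y : ∀ i, Rs i, UIRcd x y ↔ ∃ i, ¬ IsUnit (x i) ∧ ¬ IsUnit (y i) := by
      intro x y
      constructor
      · rintro ⟨z, hz, h1, h2⟩
        rw [Pi.isUnit_iff] at hz
        push Not at hz
        obtain ⟨i, hi⟩ := hz
        exact ⟨i, fun h => hi (isUnit_of_dvd_unit (pi_dvd_iff.1 h1 i) h),
          fun h => hi (isUnit_of_dvd_unit (pi_dvd_iff.1 h2 i) h)⟩
      · rintro ⟨i, h1, h2⟩
        obtain ⟨m, hm⟩ := hp i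
        have hm' : ∀ t, ¬ IsUnit t ↔ m ∣ t := by
          intro t
          rw [← Ideal.mem_span_singleton, ← mem_nonunits_iff, ← IsLocalRing.mem_maximalIdeal, hm]
        exact UIR_yes i m ((hm' m).2 dvd_rfl) ((hm' _).1 h1) ((hm' _).1 h2)
    rintro ⟨a, b, c, d, h⟩
    simp only [key, Fin.exists_fin_two] at h
    tauto
end

section
/- Let R be a finite commutative ring with unity that is not local. Then the upper ideal relation graph Γ_U(R) is a cactus graph if and only if R is isomorphic to one of the following three rings: ℤ/2ℤ × ℤ/2ℤ, ℤ/2ℤ × ℤ/3ℤ, ℤ/3ℤ × ℤ/3ℤ. -/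
/-- A cactus graph is a connected graph in which any two distinct simple cycles
(cycles being identified when they have the same edge set) have at most one vertex
in common. -/
def SimpleGraph.IsCactus {V : Type*} (G : SimpleGraph V) : Prop :=
  G.Connected ∧ ∀ ⦃u v : V⦄ (c₁ : G.Walk u u) (c₂ : G.Walk v v),
    c₁.IsCycle → c₂.IsCycle → {e | e ∈ c₁.edges} ≠ {e | e ∈ c₂.edges} →
      ∀ x y : V, x ∈ c₁.support → x ∈ c₂.support → y ∈ c₁.support → y ∈ c₂.support → x = y

namespace UIRG

lemma cactus_of_center {V : Type*} (G : SimpleGraph V) (o : V)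
    (ho : ∀ x, x ≠ o → G.Adj x o)
    (H : ∀ x y z, x ≠ o → y ≠ o → z ≠ o → G.Adj x y → G.Adj x z → y = z) : G.IsCactus := by
  have key : ∀ ⦃u : V⦄ (c : G.Walk u u), c.IsCycle → ∀ x, x ≠ o → x ∈ c.support →
      ∃ x', x' ≠ o ∧ G.Adj x x' ∧ ∀ a b, s(a, b) ∈ c.edges ↔
        (s(a, b) = s(x, o) ∨ s(a, b) = s(x, x') ∨ s(a, b) = s(x', o)) := by
    intro u c hc
    have nb : ∀ x, x ≠ o → x ∈ c.support →
        ∃ x', x' ≠ o ∧ G.Adj x x' ∧ c.toSubgraph.neighborSet x = {o, x'} := by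
      intro x hx hxs
      obtain ⟨p, q, hpq, hN⟩ := Set.ncard_eq_two.1 (hc.ncard_neighborSet_toSubgraph_eq_two hxs)
      have hp : G.Adj x p := by
        have : p ∈ c.toSubgraph.neighborSet x := by rw [hN]; simp
        exact c.toSubgraph.adj_sub this
      have hq : G.Adj x q := by
        have : q ∈ c.toSubgraph.neighborSet x := by rw [hN]; simp
        exact c.toSubgraph.adj_sub this
      by_cases h1 : p = o
      · subst h1
        exact ⟨q, hpq.symm, hq, hN⟩
      · by_cases h2 : q = o
        · subst h2
          exact ⟨p, hpq, hp, by rw [hN, Set.pair_comm]⟩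
        · exact absurd (H x p q hx h1 h2 hp hq) hpq
    intro x hx hxs
    obtain ⟨x', hx', hadj, hN⟩ := nb x hx hxs
    have e1 : c.toSubgraph.Adj x o := by
      change o ∈ c.toSubgraph.neighborSet x
      rw [hN]; simp
    have e2 : c.toSubgraph.Adj x x' := by
      change x' ∈ c.toSubgraph.neighborSet x
      rw [hN]; simp
    have hoo : ∀ w, w ≠ o → w ∈ c.support → c.toSubgraph.Adj o w := by
      intro w hw hws
      obtain ⟨w', -, -, hN'⟩ := nb w hw hws
      have : c.toSubgraph.Adj w o := by
        change o ∈ c.toSubgraph.neighborSet w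
        rw [hN']; simp
      exact this.symm
    have hx's : x' ∈ c.support := (c.mem_verts_toSubgraph).1 e2.snd_mem
    have hos : o ∈ c.support := (c.mem_verts_toSubgraph).1 e1.snd_mem
    have e3 := hoo x' hx' hx's
    obtain ⟨p, q, hpq, hNo⟩ := Set.ncard_eq_two.1 (hc.ncard_neighborSet_toSubgraph_eq_two hos)
    have hxx : x ≠ x' := hadj.ne
    have mo : ∀ w, c.toSubgraph.Adj o w → w = x ∨ w = x' := by
      have h : ∀ w, c.toSubgraph.Adj o w → w = p ∨ w = q := by
        intro w hw
        have : w ∈ c.toSubgraph.neighborSet o := hw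
        rw [hNo] at this
        simpa using this
      intro w hw
      have a1 := h w hw
      have a2 := h x e1.symm
      have a3 := h x' e3
      grind
    have mem : ∀ w ∈ c.support, w = o ∨ w = x ∨ w = x' := by
      intro w hw
      by_cases h : w = o
      · exact Or.inl h
      · exact Or.inr (mo w (hoo w h hw))
    refine ⟨x', hx', hadj, fun a b => ?_⟩
    rw [← SimpleGraph.Walk.adj_toSubgraph_iff_mem_edges]
    constructor
    · intro hab
      have m1 := mem a ((c.mem_verts_toSubgraph).1 hab.fst_mem)
      have m2 := mem b ((c.mem_verts_toSubgraph).1 hab.snd_mem)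
      have := hab.ne
      simp only [Sym2.eq_iff]
      grind
    · simp only [Sym2.eq_iff]
      have e1' := e1.symm
      have e2' := e2.symm
      have e3' := e3.symm
      rintro ((⟨rfl, rfl⟩ | ⟨rfl, rfl⟩) | (⟨rfl, rfl⟩ | ⟨rfl, rfl⟩) | (⟨rfl, rfl⟩ | ⟨rfl, rfl⟩)) <;>
        assumption
  have uniq : ∀ ⦃u v : V⦄ (c₁ : G.Walk u u) (c₂ : G.Walk v v),
    c₁.IsCycle → c₂.IsCycle → ∀ x, x ≠ o → x ∈ c₁.support → x ∈ c₂.support →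
      {e | e ∈ c₁.edges} = {e | e ∈ c₂.edges} := by
    intro u v c₁ c₂ h₁ h₂ x hx hx1 hx2
    obtain ⟨y, hy, hxy, hE⟩ := key c₁ h₁ x hx hx1
    obtain ⟨z, hz, hxz, hF⟩ := key c₂ h₂ x hx hx2
    obtain rfl := H x y z hx hy hz hxy hxz
    ext e
    induction e using Sym2.ind with
    | _ a b => simp only [Set.mem_ofPred_eq, hE, hF]
  refine ⟨?_, ?_⟩
  · rw [SimpleGraph.connected_iff_exists_forall_reachable]
    refine ⟨o, fun x => ?_⟩
    by_cases h : x = o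
    · subst h; exact SimpleGraph.Reachable.refl _
    · exact (ho x h).symm.reachable
  · intro u v c₁ c₂ h₁ h₂ hne x y hx1 hx2 hy1 hy2
    by_contra hxy
    by_cases h : x = o
    · exact hne (uniq c₁ c₂ h₁ h₂ y (by rintro rfl; exact hxy h) hy1 hy2)
    · exact hne (uniq c₁ c₂ h₁ h₂ x h hx1 hx2)

lemma no_K4 {V : Type*} (G : SimpleGraph V) (hG : G.IsCactus) (f : Fin 4 → V)
    (hf : ∀ i j, i ≠ j → G.Adj (f i) (f j)) : False := by
  have h01 := hf 0 1 (by decide)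
  have h12 := hf 1 2 (by decide)
  have h20 := hf 2 0 (by decide)
  have h13 := hf 1 3 (by decide)
  have h30 := hf 3 0 (by decide)
  have h23 := hf 2 3 (by decide)
  have hc : ∀ k (h1 : G.Adj (f 1) (f k)) (h2 : G.Adj (f k) (f 0)),
      (SimpleGraph.Walk.cons h01 (.cons h1 (.cons h2 .nil))).IsCycle := by
    intro k h1 h2
    have := h01.ne
    have := h1.ne
    have := h2.ne
    simp [SimpleGraph.Walk.cons_isCycle_iff]
    grind
  refine h01.ne (hG.2 _ _ (hc 2 h12 h20) (hc 3 h13 h30) ?_ _ _ ?_ ?_ ?_ ?_)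
  · intro h
    have : s(f 1, f 2) ∈ {e | e ∈ (SimpleGraph.Walk.cons h01 (.cons h12 (.cons h20 .nil))).edges} := by
      simp
    rw [h] at this
    have := h01.ne
    have := h12.ne
    have := h20.ne
    have := h13.ne
    have := h30.ne
    have := h23.ne
    simp at *
    grind
  all_goals simp

lemma card_le {R A B : Type*} [CommRing R] [CommRing A] [CommRing B] [Nontrivial A] [Fintype B]
    (φ : R ≃+* A × B) (hG : (upperIdealRelGraph R).IsCactus) : Fintype.card B ≤ 3 := by
  by_contra! hcard
  obtain ⟨g⟩ : Nonempty (Fin 4 ↪ B) := by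
    rw [Function.Embedding.nonempty_iff_card_le]
    simp only [Fintype.card_fin]; omega
  have hnu : ∀ b : B, ¬ IsUnit (φ.symm (0, b)) := by
    intro b hb
    have := (hb.map φ)
    rw [RingEquiv.apply_symm_apply, Prod.isUnit_iff] at this
    exact not_isUnit_zero this.1
  have hsp : ∀ b : B, Ideal.span {φ.symm (0, b)} ≤ Ideal.span {φ.symm (0, 1)} := by
    intro b
    rw [Ideal.span_singleton_le_span_singleton]
    exact ⟨φ.symm (0, b), by rw [← map_mul]; simp⟩
  refine no_K4 _ hG (fun i => ⟨φ.symm (0, g i), hnu _⟩) fun i j hij => ⟨?_, _, hnu 1, hsp _, hsp _⟩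
  intro h
  have h := congrArg Subtype.val h
  have h := φ.symm.injective h
  exact hij (g.injective (Prod.ext_iff.1 h).2)

lemma exists_idem {R : Type*} [CommRing R] [Finite R] [Nontrivial R] (hR : ¬ IsLocalRing R) :
    ∃ e : R, e * e = e ∧ e ≠ 0 ∧ e ≠ 1 := by
  have : ∃ a : R, ¬ IsUnit a ∧ ¬ IsUnit (1 - a) := by
    by_contra! h
    exact hR (IsLocalRing.of_isUnit_or_isUnit_one_sub_self fun a => or_iff_not_imp_left.2 (h a))
  obtain ⟨a, ha, ha'⟩ := this
  obtain ⟨i, j, hij, h⟩ : ∃ i j : ℕ, i < j ∧ a ^ (i + 1) = a ^ (j + 1) := by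
    obtain ⟨i, j, hne, h⟩ := Finite.exists_ne_map_eq_of_infinite (fun n : ℕ => a ^ (n + 1))
    rcases lt_or_gt_of_ne hne with h' | h'
    · exact ⟨i, j, h', h⟩
    · exact ⟨j, i, h', h.symm⟩
  obtain ⟨k, rfl⟩ := Nat.exists_eq_add_of_lt hij
  have hper : ∀ t, a ^ (i + 1 + t * (k + 1)) = a ^ (i + 1) := by
    intro t
    induction t with
    | zero => simp
    | succ t ih =>
      calc a ^ (i + 1 + (t + 1) * (k + 1)) = a ^ (i + 1 + t * (k + 1)) * a ^ (k + 1) := by ring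
        _ = a ^ (i + k + 1 + 1) := by rw [ih]; ring
        _ = _ := h.symm
  refine ⟨a ^ ((i + 1) * (k + 1)), ?_, ?_, ?_⟩
  · have e : (i + 1) * (k + 1) = i + 1 + (i + 1) * k := by ring
    calc a ^ ((i + 1) * (k + 1)) * a ^ ((i + 1) * (k + 1))
        = a ^ (i + 1 + (i + 1) * (k + 1)) * a ^ ((i + 1) * k) := by
          rw [← pow_add, ← pow_add]; congr 1; ring
      _ = a ^ ((i + 1) * (k + 1)) := by rw [hper, ← pow_add]; congr 1; ring
  · intro h0
    exact ha' (IsNilpotent.isUnit_one_sub ⟨_, h0⟩)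
  · intro h1
    exact ha (IsUnit.of_pow_eq_one h1 (by positivity))

lemma cactus_of_equiv {R A B : Type*} [CommRing R] [Field A] [Field B] (φ : R ≃+* A × B)
    (hA : ∀ a b c : A, a ≠ 0 → b ≠ 0 → c ≠ 0 → a ≠ b → a ≠ c → b = c)
    (hB : ∀ a b c : B, a ≠ 0 → b ≠ 0 → c ≠ 0 → a ≠ b → a ≠ c → b = c) :
    (upperIdealRelGraph R).IsCactus := by
  have : Nontrivial R := φ.toEquiv.nontrivial
  have adj : ∀ x y, (upperIdealRelGraph R).Adj x y → φ x ≠ φ y ∧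
      (((φ x).1 = 0 ∧ (φ y).1 = 0) ∨ ((φ x).2 = 0 ∧ (φ y).2 = 0)) := by
    rintro x y ⟨hne, z, hz, h1, h2⟩
    refine ⟨fun h => hne (Subtype.ext (φ.injective h)), ?_⟩
    rw [Ideal.span_singleton_le_span_singleton] at h1 h2
    obtain ⟨r, hr⟩ := h1
    obtain ⟨s, hs⟩ := h2
    rw [hr, hs, map_mul, map_mul]
    have : ¬ IsUnit (φ z) := by rwa [MulEquiv.isUnit_map]
    rw [Prod.isUnit_iff, isUnit_iff_ne_zero, isUnit_iff_ne_zero] at this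
    by_cases h : (φ z).1 = 0
    · left; simp [h]
    · right
      have : (φ z).2 = 0 := by tauto
      simp [this]
  refine cactus_of_center _ ⟨0, not_isUnit_zero⟩ ?_ ?_
  · intro x hx
    refine ⟨hx, x, x.2, le_rfl, ?_⟩
    simp
  · intro x y z hx hy hz hxy hxz
    have nz : ∀ w : {x : R // ¬ IsUnit x}, w ≠ ⟨0, not_isUnit_zero⟩ → φ w ≠ 0 := by
      intro w hw h
      exact hw (Subtype.ext ((map_eq_zero_iff φ φ.injective).1 h))
    have hx := nz x hx
    have hy := nz y hy
    have hz := nz z hz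
    have h1 := adj x y hxy
    have h2 := adj x z hxz
    apply Subtype.ext
    apply φ.injective
    generalize φ x = X at *
    generalize φ y = Y at *
    generalize φ z = Z at *
    obtain ⟨x1, x2⟩ := X
    obtain ⟨y1, y2⟩ := Y
    obtain ⟨z1, z2⟩ := Z
    simp only [ne_eq, Prod.mk.injEq, Prod.mk_eq_zero] at *
    have := hA x1 y1 z1
    have := hB x2 y2 z2
    grind

lemma z2 (a b c : ZMod 2) (ha : a ≠ 0) (hb : b ≠ 0) (hc : c ≠ 0) (hab : a ≠ b) (hac : a ≠ c) :
    b = c := by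
  have h : ∀ a b c : Fin 2, ¬ a = 0 → ¬ b = 0 → ¬ c = 0 → ¬ a = b → ¬ a = c → b = c := by
    intro a b c
    fin_cases a <;> fin_cases b <;> fin_cases c <;> simp
  exact h a b c ha hb hc hab hac
lemma z3 (a b c : ZMod 3) (ha : a ≠ 0) (hb : b ≠ 0) (hc : c ≠ 0) (hab : a ≠ b) (hac : a ≠ c) :
    b = c := by
  have h : ∀ a b c : Fin 3, ¬ a = 0 → ¬ b = 0 → ¬ c = 0 → ¬ a = b → ¬ a = c → b = c := by
    intro a b c
    fin_cases a <;> fin_cases b <;> fin_cases c <;> simp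
  exact h a b c ha hb hc hab hac

lemma small {B : Type*} [CommRing B] [Fintype B] [Nontrivial B] (h : Fintype.card B ≤ 3) :
    Nonempty (B ≃+* ZMod 2) ∨ Nonempty (B ≃+* ZMod 3) := by
  have := Fintype.one_lt_card (α := B)
  have : Fintype.card B = 2 ∨ Fintype.card B = 3 := by omega
  rcases this with h | h
  · exact Or.inl ⟨(ZMod.ringEquivOfPrime B Nat.prime_two h).symm⟩
  · exact Or.inr ⟨(ZMod.ringEquivOfPrime B Nat.prime_three h).symm⟩

lemma exists_prod {R : Type*} [CommRing R] (e : R) (he : e * e = e) :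
    Nonempty (R ≃+* (R ⧸ Ideal.span {e}) × (R ⧸ Ideal.span {1 - e})) := by
  have hco : IsCoprime (Ideal.span {e}) (Ideal.span {1 - e}) := by
    rw [Ideal.isCoprime_span_singleton_iff]
    exact ⟨1, 1, by ring⟩
  have h0 : Ideal.span {e} * Ideal.span {1 - e} = ⊥ := by
    rw [Ideal.span_singleton_mul_span_singleton, mul_sub, he]; simp
  exact ⟨((RingEquiv.quotientBot R).symm.trans (Ideal.quotEquivOfEq h0.symm)).trans
    (Ideal.quotientMulEquivQuotientProd _ _ hco)⟩

lemma idem_not_unit {R : Type*} [CommRing R] (e : R) (he : e * e = e) (h1 : e ≠ 1) :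
    ¬ IsUnit e := fun h => h1 (h.mul_left_cancel (by rw [he, mul_one]))

end UIRG

theorem upperIdealRelGraph_isCactus_iff (R : Type*) [CommRing R] [Fintype R]
    (hR : ¬ IsLocalRing R) :
    (upperIdealRelGraph R).IsCactus ↔
      (Nonempty (R ≃+* (ZMod 2 × ZMod 2)) ∨ Nonempty (R ≃+* (ZMod 2 × ZMod 3)) ∨
        Nonempty (R ≃+* (ZMod 3 × ZMod 3))) := by
  classical
  constructor
  · intro hG
    have : Nontrivial R := by
      obtain ⟨x⟩ := hG.1.nonempty
      exact nontrivial_of_ne (x : R) 1 (fun h => x.2 (h ▸ isUnit_one))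
    obtain ⟨e, he, h0, h1⟩ := UIRG.exists_idem hR
    obtain ⟨φ⟩ := UIRG.exists_prod e he
    have n1 : Nontrivial (R ⧸ Ideal.span {e}) := by
      rw [Ideal.Quotient.nontrivial_iff, Ne, Ideal.span_singleton_eq_top]
      exact UIRG.idem_not_unit e he h1
    have n2 : Nontrivial (R ⧸ Ideal.span {1 - e}) := by
      rw [Ideal.Quotient.nontrivial_iff, Ne, Ideal.span_singleton_eq_top]
      refine UIRG.idem_not_unit (1 - e) (by linear_combination he) ?_
      intro h
      exact h0 (by linear_combination -h)
    have f1 : Fintype (R ⧸ Ideal.span {e}) := Fintype.ofFinite _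
    have f2 : Fintype (R ⧸ Ideal.span {1 - e}) := Fintype.ofFinite _
    have c2 := UIRG.card_le φ hG
    have c1 := UIRG.card_le (φ.trans RingEquiv.prodComm) hG
    rcases UIRG.small c1 with ⟨⟨a⟩⟩ | ⟨⟨a⟩⟩ <;> rcases UIRG.small c2 with ⟨⟨b⟩⟩ | ⟨⟨b⟩⟩
    · exact Or.inl ⟨φ.trans (RingEquiv.prodCongr a b)⟩
    · exact Or.inr (Or.inl ⟨φ.trans (RingEquiv.prodCongr a b)⟩)
    · exact Or.inr (Or.inl ⟨(φ.trans (RingEquiv.prodCongr a b)).trans RingEquiv.prodComm⟩)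
    · exact Or.inr (Or.inr ⟨φ.trans (RingEquiv.prodCongr a b)⟩)
  · have : Fact (Nat.Prime 2) := ⟨Nat.prime_two⟩
    have : Fact (Nat.Prime 3) := ⟨Nat.prime_three⟩
    rintro (⟨⟨φ⟩⟩ | ⟨⟨φ⟩⟩ | ⟨⟨φ⟩⟩)
    · exact UIRG.cactus_of_equiv φ UIRG.z2 UIRG.z2
    · exact UIRG.cactus_of_equiv φ UIRG.z2 UIRG.z3
    · exact UIRG.cactus_of_equiv φ UIRG.z3 UIRG.z3
end

section
/- Let R be a finite commutative ring with unity that is not local. Then the upper ideal relation graph Γ_U(R) is unicyclic if and only if R is isomorphic to ℤ/2ℤ × ℤ/3ℤ. -/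
/-- A connected graph is unicyclic if it contains exactly one cycle (cycles being
identified when they have the same edge set). -/
def SimpleGraph.IsUnicyclic {V : Type*} (G : SimpleGraph V) : Prop :=
  G.Connected ∧ (∃ (u : V) (c : G.Walk u u), c.IsCycle) ∧
    ∀ ⦃u v : V⦄ (c₁ : G.Walk u u) (c₂ : G.Walk v v), c₁.IsCycle → c₂.IsCycle →
      {e | e ∈ c₁.edges} = {e | e ∈ c₂.edges}


namespace UIRG

lemma triangle {V : Type*} {G : SimpleGraph V} {a b c : V} (h1 : G.Adj a b) (h2 : G.Adj b c)
    (h3 : G.Adj c a) : ∃ w : G.Walk a a, w.IsCycle ∧ w.edges = [s(a,b), s(b,c), s(c,a)] := by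
  refine ⟨.cons h1 (.cons h2 (.cons h3 .nil)), ?_, by simp⟩
  have := h1.ne
  have := h2.ne
  have := h3.ne
  rw [SimpleGraph.Walk.isCycle_def, SimpleGraph.Walk.isTrail_def]
  simp
  grind

lemma uniq {V : Type*} {G : SimpleGraph V} (hG : G.IsUnicyclic) {a b c a' b' c' : V}
    (h1 : G.Adj a b) (h2 : G.Adj b c) (h3 : G.Adj c a)
    (h1' : G.Adj a' b') (h2' : G.Adj b' c') (h3' : G.Adj c' a') :
    s(b, c) ∈ [s(a', b'), s(b', c'), s(c', a')] := by
  obtain ⟨w, hw, e⟩ := triangle h1 h2 h3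
  obtain ⟨w', hw', e'⟩ := triangle h1' h2' h3'
  have h := hG.2.2 w w' hw hw'
  have : s(b, c) ∈ {e | e ∈ w.edges} := by simp [e]
  rw [h] at this
  rw [← e']
  exact this

lemma transfer {V W : Type*} {G : SimpleGraph V} {H : SimpleGraph W} (f : G ≃g H)
    (h : G.IsUnicyclic) : H.IsUnicyclic := by
  obtain ⟨hc, ⟨u, c, hcy⟩, hu⟩ := h
  refine ⟨f.connected_iff.mp hc, ⟨f u, c.map f.toHom, hcy.map f.injective⟩, ?_⟩
  intro u v c₁ c₂ h₁ h₂
  have := hu (c₁.map f.symm.toHom) (c₂.map f.symm.toHom) (h₁.map f.symm.injective)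
    (h₂.map f.symm.injective)
  simp only [SimpleGraph.Walk.edges_map] at this
  have inj : Function.Injective (Sym2.map f.symm.toHom) := Sym2.map.injective f.symm.injective
  ext e
  have h2 := Set.ext_iff.mp this (Sym2.map f.symm.toHom e)
  simpa only [Set.mem_ofPred_eq, List.mem_map_of_injective inj] using h2

lemma adj_iff {R : Type*} [CommRing R] (x y : {x : R // ¬ IsUnit x}) :
    (upperIdealRelGraph R).Adj x y ↔ (x : R) ≠ y ∧ ∃ z : R, ¬ IsUnit z ∧ z ∣ x ∧ z ∣ y := by
  simp only [upperIdealRelGraph, Ideal.span_singleton_le_span_singleton, Subtype.ext_iff, Ne]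

def iso {R S : Type*} [CommRing R] [CommRing S] (f : R ≃+* S) :
    upperIdealRelGraph R ≃g upperIdealRelGraph S where
  toEquiv := f.toEquiv.subtypeEquiv (fun a => by simp)
  map_rel_iff' := by
    intro a b
    rw [adj_iff, adj_iff]
    refine and_congr (by simp) ?_
    constructor
    · rintro ⟨z, hz, h1, h2⟩
      refine ⟨f.symm z, by simpa using hz, ?_, ?_⟩
      · simpa using map_dvd f.symm h1
      · simpa using map_dvd f.symm h2
    · rintro ⟨z, hz, h1, h2⟩
      exact ⟨f z, by simpa using hz, map_dvd f h1, map_dvd f h2⟩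

lemma split (R : Type*) [CommRing R] [Fintype R] [Nontrivial R] (hR : ¬ IsLocalRing R) :
    ∃ I J : Ideal R, I ≠ ⊤ ∧ J ≠ ⊤ ∧ Nonempty (R ≃+* (R ⧸ I) × (R ⧸ J)) := by
  have : ∃ a : R, ¬ IsUnit a ∧ ¬ IsUnit (1 - a) := by
    by_contra! h
    exact hR (IsLocalRing.of_isUnit_or_isUnit_one_sub_self fun a => by
      by_cases ha : IsUnit a
      · exact Or.inl ha
      · exact Or.inr (h a ha))
  obtain ⟨a, ha, ha'⟩ := this
  obtain ⟨n, hn, he⟩ : ∃ n : ℕ, 0 < n ∧ a ^ n * a ^ n = a ^ n := by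
    obtain ⟨i, j, hij, h⟩ := Finite.exists_ne_map_eq_of_infinite (fun n : ℕ => a ^ n)
    wlog hlt : i < j generalizing i j
    · exact this j i hij.symm h.symm (by omega)
    obtain ⟨d, rfl⟩ := Nat.exists_eq_add_of_lt hlt
    have key : ∀ k m, i ≤ m → a ^ (m + k * (d + 1)) = a ^ m := by
      intro k
      induction k with
      | zero => simp
      | succ k ih =>
        intro m hm
        obtain ⟨t, rfl⟩ := Nat.exists_eq_add_of_le hm
        have : i + t + (k + 1) * (d + 1) = (i + d + 1) + t + k * (d + 1) := by ring
        rw [this, ih _ (by omega), pow_add _ _ t, ← h, ← pow_add]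
    refine ⟨(i + 1) * (d + 1), by positivity, ?_⟩
    rw [← pow_add]
    exact key (i + 1) _ (by nlinarith)
  set e := a ^ n with hedef
  have he1 : ¬ IsUnit e := fun h => ha ((isUnit_pow_iff hn.ne').mp h)
  have he2 : ¬ IsUnit (1 - e) := by
    intro h
    have h0 : e = 0 := by
      have : (1 - e) * e = 0 := by linear_combination -he
      exact (h.mul_right_eq_zero).mp this
    exact ha' (IsNilpotent.isUnit_one_sub ⟨n, h0⟩)
  refine ⟨Ideal.span {e}, Ideal.span {1 - e}, by rwa [Ne, Ideal.span_singleton_eq_top],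
    by rwa [Ne, Ideal.span_singleton_eq_top], ⟨?_⟩⟩
  have hb : Ideal.span {e} * Ideal.span {1 - e} = (⊥ : Ideal R) := by
    rw [Ideal.span_singleton_mul_span_singleton, Ideal.span_singleton_eq_bot]
    linear_combination -he
  have hc : IsCoprime (Ideal.span {e}) (Ideal.span {1 - e}) := by
    rw [Ideal.isCoprime_span_singleton_iff]
    exact ⟨1, 1, by ring⟩
  exact ((RingEquiv.quotientBot R).symm.trans (Ideal.quotEquivOfEq hb.symm)).trans
    (Ideal.quotientMulEquivQuotientProd _ _ hc)

section prod
variable {A B : Type*} [CommRing A] [CommRing B] 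

def vl [Nontrivial B] (a : A) : {x : A × B // ¬ IsUnit x} := ⟨(a, 0), by simp [Prod.isUnit_iff]⟩
def vr [Nontrivial A] (b : B) : {x : A × B // ¬ IsUnit x} := ⟨(0, b), by simp [Prod.isUnit_iff]⟩

lemma vl_inj [Nontrivial B] {x y : A} : (vl x : {x : A × B // ¬ IsUnit x}) = vl y ↔ x = y := by
  simp [vl]

lemma adj_l [Nontrivial B] {x y : A} (h : x ≠ y) :
    (upperIdealRelGraph (A × B)).Adj (vl x) (vl y) := by
  rw [adj_iff]
  exact ⟨by simpa [vl] using h, (1, 0), by simp [Prod.isUnit_iff], ⟨(x, 0), by simp [vl]⟩,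
    ⟨(y, 0), by simp [vl]⟩⟩

lemma adj_r [Nontrivial A] {x y : B} (h : x ≠ y) :
    (upperIdealRelGraph (A × B)).Adj (vr x) (vr y) := by
  rw [adj_iff]
  exact ⟨by simpa [vr] using h, (0, 1), by simp [Prod.isUnit_iff], ⟨(0, x), by simp [vr]⟩,
    ⟨(0, y), by simp [vr]⟩⟩

lemma card_le_s4 [Nontrivial B] [Fintype A]
    (h : (upperIdealRelGraph (A × B)).IsUnicyclic) : Fintype.card A ≤ 3 := by
  classical
  by_contra! hc
  have : 2 < (Finset.univ.erase (0 : A)).card := by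
    rw [Finset.card_erase_of_mem (Finset.mem_univ _), Finset.card_univ]; omega
  obtain ⟨x, hx, y, hy, z, hz, hxy, hxz, hyz⟩ := Finset.two_lt_card.mp this
  simp only [Finset.mem_erase, Finset.mem_univ, and_true] at hx hy hz
  have := uniq h (adj_l hx.symm) (adj_l hxy) (adj_l hy)
    (adj_l hx.symm) (adj_l hxz) (adj_l hz)
  simp only [List.mem_cons, Sym2.eq_iff, vl_inj, List.not_mem_nil] at this
  grind

lemma not_both [Nontrivial A] [Nontrivial B] [Fintype A] [Fintype B]
    (h : (upperIdealRelGraph (A × B)).IsUnicyclic) (hA : 3 ≤ Fintype.card A)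
    (hB : 3 ≤ Fintype.card B) : False := by
  classical
  have h1 : 1 < (Finset.univ.erase (0 : A)).card := by
    rw [Finset.card_erase_of_mem (Finset.mem_univ _), Finset.card_univ]; omega
  have h2 : 1 < (Finset.univ.erase (0 : B)).card := by
    rw [Finset.card_erase_of_mem (Finset.mem_univ _), Finset.card_univ]; omega
  obtain ⟨x, hx, y, hy, hxy⟩ := Finset.one_lt_card.mp h1
  obtain ⟨x', hx', y', hy', hxy'⟩ := Finset.one_lt_card.mp h2
  simp only [Finset.mem_erase, Finset.mem_univ, and_true] at hx hy hx' hy'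
  have := uniq h (adj_l hx.symm) (adj_l hxy) (adj_l hy)
    (adj_r hx'.symm) (adj_r hxy') (adj_r hy')
  simp only [List.mem_cons, Sym2.eq_iff, vl, vr, Subtype.mk.injEq, Prod.mk.injEq,
    List.not_mem_nil] at this
  grind
end prod

lemma isUnit_iff' {R : Type*} [CommRing R] (x : R) : IsUnit x ↔ ∃ y, x * y = 1 :=
  isUnit_iff_exists_inv

lemma adj_iff' {R : Type*} [CommRing R] (x y : {x : R // ¬ IsUnit x}) :
    (upperIdealRelGraph R).Adj x y ↔ (x : R) ≠ y ∧ ∃ z : R, (¬ ∃ y, z * y = 1) ∧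
      (∃ c, (x : R) = z * c) ∧ (∃ c, (y : R) = z * c) := by
  simp only [adj_iff, isUnit_iff', Dvd.dvd]

lemma no22 : ¬ (upperIdealRelGraph (ZMod 2 × ZMod 2)).IsUnicyclic := by
  rintro ⟨-, ⟨u, c, hc⟩, -⟩
  have h3 := hc.three_le_length
  let E : Finset (Sym2 (ZMod 2 × ZMod 2)) := {s((0,0),(0,1)), s((0,0),(1,0))}
  have hsub : ∀ e ∈ c.edges.map (Sym2.map Subtype.val), e ∈ E := by
    intro e he
    obtain ⟨e, hec, rfl⟩ := List.mem_map.mp he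
    have := c.edges_subset_edgeSet hec
    induction e with
    | _ x y =>
      rw [SimpleGraph.mem_edgeSet, adj_iff'] at this
      revert this
      rw [Sym2.map_mk]
      obtain ⟨x, hx⟩ := x
      obtain ⟨y, hy⟩ := y
      clear he hec
      simp only
      clear hx hy
      revert x y
      decide
  have hnd : (c.edges.map (Sym2.map Subtype.val)).Nodup :=
    hc.edges_nodup.map (Sym2.map.injective Subtype.val_injective)
  have := Finset.card_le_card (s := (c.edges.map (Sym2.map Subtype.val)).toFinset) (t := E)
    (fun e he => hsub e (by simpa using he))
  rw [List.toFinset_card_of_nodup hnd] at this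
  simp only [List.length_map, SimpleGraph.Walk.length_edges] at this
  have : E.card = 2 := by decide
  omega

set_option synthInstance.maxHeartbeats 400000 in
set_option synthInstance.maxSize 2000 in
set_option maxRecDepth 100000 in
lemma yes23 : (upperIdealRelGraph (ZMod 2 × ZMod 3)).IsUnicyclic := by
  have huniq : ∀ ⦃u⦄ (c : (upperIdealRelGraph (ZMod 2 × ZMod 3)).Walk u u), c.IsCycle →
      (c.edges.map (Sym2.map Subtype.val)).toFinset =
        {s((0,0),(0,1)), s((0,0),(0,2)), s((0,1),(0,2))} := by
    intro u c hc
    have h3 := hc.three_le_length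
    let z : {x : ZMod 2 × ZMod 3 // ¬ IsUnit x} := vl 0
    let v : {x : ZMod 2 × ZMod 3 // ¬ IsUnit x} := vl 1
    have hzv : (upperIdealRelGraph (ZMod 2 × ZMod 3)).Adj z v := adj_l (by decide)
    have hv : ∀ w, (upperIdealRelGraph (ZMod 2 × ZMod 3)).Adj v w → w = z := by
      intro w hw
      rw [adj_iff'] at hw
      obtain ⟨w, hw'⟩ := w
      rw [Subtype.ext_iff]
      simp only [v, z, vl] at hw ⊢
      clear hw'
      revert w
      decide
    have hbr : s(z, v) ∉ c.edges := by
      have hb : (upperIdealRelGraph (ZMod 2 × ZMod 3)).IsBridge s(z, v) := by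
        rw [SimpleGraph.isBridge_iff]
        rintro ⟨p⟩
        obtain ⟨w, h, -, -⟩ := p.reverse.exists_eq_cons_of_ne hzv.ne.symm
        rw [SimpleGraph.deleteEdges_adj] at h
        obtain ⟨h, h'⟩ := h
        rw [hv _ h] at h'
        exact h' (by simp [Sym2.eq_swap])
      exact (SimpleGraph.isBridge_iff_forall_cycle_notMem hzv).mp hb c hc
    have hnd : (c.edges.map (Sym2.map Subtype.val)).Nodup :=
      hc.edges_nodup.map (Sym2.map.injective Subtype.val_injective)
    apply Finset.eq_of_subset_of_card_le
    · intro e he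
      rw [List.mem_toFinset] at he
      obtain ⟨e, hec, rfl⟩ := List.mem_map.mp he
      have := c.edges_subset_edgeSet hec
      have hne : Sym2.map Subtype.val e ≠ s((0,0),(1,0)) := by
        intro h
        apply hbr
        have : e = s(z, v) := Sym2.map.injective Subtype.val_injective (by rw [h]; rfl)
        rwa [this] at hec
      induction e with
      | _ x y =>
        rw [SimpleGraph.mem_edgeSet, adj_iff'] at this
        revert this hne
        rw [Sym2.map_mk]
        obtain ⟨x, hx⟩ := x
        obtain ⟨y, hy⟩ := y
        clear he hec
        simp only
        clear hx hy
        revert x y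
        decide
    · rw [List.toFinset_card_of_nodup hnd]
      simp only [List.length_map, SimpleGraph.Walk.length_edges]
      exact le_trans (by decide) h3
  refine ⟨?_, ?_, ?_⟩
  · have h0 : ∀ x, (upperIdealRelGraph (ZMod 2 × ZMod 3)).Reachable (vl 0) x := by
      intro x
      by_cases hx : vl 0 = x
      · rw [hx]
      · apply SimpleGraph.Adj.reachable
        rw [adj_iff]
        exact ⟨fun h => hx (Subtype.ext h), x, x.2, by simp [vl, ← Prod.zero_eq_mk], dvd_rfl⟩
    have : Nonempty {x : ZMod 2 × ZMod 3 // ¬ IsUnit x} := ⟨vl 0⟩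
    exact ⟨fun x y => (h0 x).symm.trans (h0 y)⟩
  · obtain ⟨w, hw, -⟩ := triangle (G := upperIdealRelGraph (ZMod 2 × ZMod 3))
      (adj_r (x := 0) (y := 1) (by decide)) (adj_r (x := 1) (y := 2) (by decide))
      (adj_r (x := 2) (y := 0) (by decide))
    exact ⟨_, w, hw⟩
  · intro u v c₁ c₂ h₁ h₂
    have h := (huniq c₁ h₁).trans (huniq c₂ h₂).symm
    have inj : Function.Injective (Sym2.map (Subtype.val : {x : ZMod 2 × ZMod 3 // ¬ IsUnit x} → _)) :=
      Sym2.map.injective Subtype.val_injective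
    ext e
    have h2 := Finset.ext_iff.mp h (Sym2.map Subtype.val e)
    simpa only [List.mem_toFinset, Set.mem_ofPred_eq, List.mem_map_of_injective inj] using h2

end UIRG

theorem upperIdealRelGraph_isUnicyclic_iff (R : Type*) [CommRing R] [Fintype R]
    (hR : ¬ IsLocalRing R) :
    (upperIdealRelGraph R).IsUnicyclic ↔ Nonempty (R ≃+* (ZMod 2 × ZMod 3)) := by
  classical
  constructor
  · intro h
    have : Nontrivial R := by
      obtain ⟨x, hx⟩ := h.1.nonempty
      by_contra hn
      rw [not_nontrivial_iff_subsingleton] at hn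
      exact hx (isUnit_of_subsingleton x)
    obtain ⟨I, J, hI, hJ, ⟨f⟩⟩ := UIRG.split R hR
    have := Ideal.Quotient.nontrivial_iff.mpr hI
    have := Ideal.Quotient.nontrivial_iff.mpr hJ
    have := Fintype.ofFinite (R ⧸ I)
    have := Fintype.ofFinite (R ⧸ J)
    have h1 := UIRG.transfer (UIRG.iso f) h
    have h2 := UIRG.transfer (UIRG.iso (f.trans RingEquiv.prodComm)) h
    have a1 := UIRG.card_le_s4 h1
    have a2 := UIRG.card_le_s4 h2
    have a3 := Fintype.one_lt_card (α := R ⧸ I)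
    have a4 := Fintype.one_lt_card (α := R ⧸ J)
    have a5 := UIRG.not_both h1
    have p2 : Nat.Prime 2 := Nat.prime_two
    have p3 : Nat.Prime 3 := Nat.prime_three
    rcases (show Fintype.card (R ⧸ I) = 2 ∨ Fintype.card (R ⧸ I) = 3 by omega) with hA | hA <;>
    rcases (show Fintype.card (R ⧸ J) = 2 ∨ Fintype.card (R ⧸ J) = 3 by omega) with hB | hB
    · exact absurd (UIRG.transfer (UIRG.iso (f.trans (RingEquiv.prodCongr
        (ZMod.ringEquivOfPrime _ p2 hA).symm (ZMod.ringEquivOfPrime _ p2 hB).symm))) h) UIRG.no22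
    · exact ⟨f.trans (RingEquiv.prodCongr
        (ZMod.ringEquivOfPrime _ p2 hA).symm (ZMod.ringEquivOfPrime _ p3 hB).symm)⟩
    · exact ⟨(f.trans RingEquiv.prodComm).trans (RingEquiv.prodCongr
        (ZMod.ringEquivOfPrime _ p2 hB).symm (ZMod.ringEquivOfPrime _ p3 hA).symm)⟩
    · exact (a5 (by omega) (by omega)).elim
  · rintro ⟨f⟩
    exact UIRG.transfer (UIRG.iso f.symm) UIRG.yes23
end

section
/- Let F1 and F2 be finite fields and R = F1 × F2. Then in the upper ideal relation graph Γ_U(R): the vertex (0,0) is adjacent to every other vertex; any two distinct vertices of the form (a,0) with a ≠ 0 are adjacent; any two distinct vertices of the form (0,b) with b ≠ 0 are adjacent; and no vertex (a,0) with a ≠ 0 is adjacent to any vertex (0,b) with b ≠ 0. Consequently Γ_U(F1 × F2) is isomorphic to the join K1 ∨ (K_{|F1|−1} ∪ K_{|F2|−1}). -/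
/-- The join of two graphs: their disjoint union together with all edges between the
two parts. -/
def SimpleGraph.join {α β : Type*} (G : SimpleGraph α) (H : SimpleGraph β) :
    SimpleGraph (α ⊕ β) where
  Adj x y := match x, y with
    | Sum.inl a, Sum.inl b => G.Adj a b
    | Sum.inr a, Sum.inr b => H.Adj a b
    | Sum.inl _, Sum.inr _ => True
    | Sum.inr _, Sum.inl _ => True
  symm := by constructor; rintro (a | a) (b | b) h <;> first | exact G.adj_symm h | exact H.adj_symm h | trivial
  loopless := by constructor; rintro (a | a) h <;> exact SimpleGraph.irrefl _ h

theorem uirg_nonunit (F1 F2 : Type*) [Field F1] [Field F2] (z : F1 × F2) :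
    ¬ IsUnit z ↔ z.1 = 0 ∨ z.2 = 0 := by
  rw [Prod.isUnit_iff, isUnit_iff_ne_zero, isUnit_iff_ne_zero]
  tauto

theorem uirg_adj (F1 F2 : Type*) [Field F1] [Field F2] (x y : {x : F1 × F2 // ¬ IsUnit x}) :
    (upperIdealRelGraph (F1 × F2)).Adj x y ↔
      x ≠ y ∧ ((x.1.1 = 0 ∧ y.1.1 = 0) ∨ (x.1.2 = 0 ∧ y.1.2 = 0)) := by
  show (x ≠ y ∧ _) ↔ _
  refine and_congr_right fun _ => ?_
  simp only [Ideal.span_singleton_le_span_singleton]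
  constructor
  · rintro ⟨z, hz, ⟨c, hc⟩, ⟨d, hd⟩⟩
    rw [uirg_nonunit] at hz
    rw [hc, hd]
    rcases hz with hz | hz
    · left; simp [hz]
    · right; simp [hz]
  · rintro (⟨h1, h2⟩ | ⟨h1, h2⟩)
    · refine ⟨(0, 1), by simp [uirg_nonunit], ⟨x.1, ?_⟩, ⟨y.1, ?_⟩⟩ <;> ext <;> simp [h1, h2]
    · refine ⟨(1, 0), by simp [uirg_nonunit], ⟨x.1, ?_⟩, ⟨y.1, ?_⟩⟩ <;> ext <;> simp [h1, h2]

theorem upperIdealRelGraph_prod_fields (F1 F2 : Type*) [Field F1] [Field F2]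
    [Fintype F1] [Fintype F2] :
    (∀ v w : {x : F1 × F2 // ¬ IsUnit x}, v.1 = (0, 0) → w ≠ v →
        (upperIdealRelGraph (F1 × F2)).Adj v w) ∧
    (∀ v w : {x : F1 × F2 // ¬ IsUnit x}, (∃ a : F1, a ≠ 0 ∧ v.1 = (a, 0)) →
        (∃ a : F1, a ≠ 0 ∧ w.1 = (a, 0)) → v ≠ w →
        (upperIdealRelGraph (F1 × F2)).Adj v w) ∧
    (∀ v w : {x : F1 × F2 // ¬ IsUnit x}, (∃ b : F2, b ≠ 0 ∧ v.1 = (0, b)) →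
        (∃ b : F2, b ≠ 0 ∧ w.1 = (0, b)) → v ≠ w →
        (upperIdealRelGraph (F1 × F2)).Adj v w) ∧
    (∀ v w : {x : F1 × F2 // ¬ IsUnit x}, (∃ a : F1, a ≠ 0 ∧ v.1 = (a, 0)) →
        (∃ b : F2, b ≠ 0 ∧ w.1 = (0, b)) → ¬ (upperIdealRelGraph (F1 × F2)).Adj v w) ∧
    Nonempty ((upperIdealRelGraph (F1 × F2)) ≃g
      SimpleGraph.join (⊤ : SimpleGraph (Fin 1))
        ((⊤ : SimpleGraph (Fin (Fintype.card F1 - 1))) ⊕g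
          (⊤ : SimpleGraph (Fin (Fintype.card F2 - 1))))) := by
  refine ⟨?_, ?_, ?_, ?_, ?_⟩
  · intro v w hv hne
    rw [uirg_adj]
    refine ⟨hne.symm, ?_⟩
    have := (uirg_nonunit F1 F2 w.1).1 w.2
    simpa [hv] using this
  · rintro v w ⟨a, -, hv⟩ ⟨b, -, hw⟩ hne
    rw [uirg_adj]
    exact ⟨hne, by simp [hv, hw]⟩
  · rintro v w ⟨a, -, hv⟩ ⟨b, -, hw⟩ hne
    rw [uirg_adj]
    exact ⟨hne, by simp [hv, hw]⟩
  · rintro v w ⟨a, ha, hv⟩ ⟨b, hb, hw⟩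
    rw [uirg_adj]
    simp [hv, hw, ha, hb]
  · classical
    have c1 : Fintype.card {a : F1 // a ≠ 0} = Fintype.card F1 - 1 := by
      simp [Fintype.card_subtype_compl]
    have c2 : Fintype.card {a : F2 // a ≠ 0} = Fintype.card F2 - 1 := by
      simp [Fintype.card_subtype_compl]
    let e1 := (Fintype.equivFinOfCardEq c1).symm
    let e2 := (Fintype.equivFinOfCardEq c2).symm
    let f : Fin 1 ⊕ (Fin (Fintype.card F1 - 1) ⊕ Fin (Fintype.card F2 - 1)) →
        {x : F1 × F2 // ¬ IsUnit x} := fun s => match s with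
      | .inl _ => ⟨(0, 0), by simp [uirg_nonunit]⟩
      | .inr (.inl i) => ⟨((e1 i).1, 0), by simp [uirg_nonunit]⟩
      | .inr (.inr i) => ⟨(0, (e2 i).1), by simp [uirg_nonunit]⟩
    have n1 : ∀ i, (e1 i).1 ≠ 0 := fun i => (e1 i).2
    have n2 : ∀ i, (e2 i).1 ≠ 0 := fun i => (e2 i).2
    have inj : Function.Injective f := by
      rintro (i | i | i) (j | j | j) h
      · rw [Subsingleton.elim i j]
      · exact absurd (congrArg (fun t => t.1.1) h).symm (n1 j)
      · exact absurd (congrArg (fun t => t.1.2) h).symm (n2 j)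
      · exact absurd (congrArg (fun t => t.1.1) h) (n1 i)
      · rw [e1.injective (Subtype.ext (congrArg (fun t => t.1.1) h))]
      · exact absurd (congrArg (fun t => t.1.1) h) (n1 i)
      · exact absurd (congrArg (fun t => t.1.2) h) (n2 i)
      · exact absurd (congrArg (fun t => t.1.2) h) (n2 i)
      · rw [e2.injective (Subtype.ext (congrArg (fun t => t.1.2) h))]
    have surj : Function.Surjective f := by
      rintro ⟨⟨a, b⟩, h⟩
      have h' := (uirg_nonunit F1 F2 (a, b)).1 h
      by_cases ha : a = 0
      · by_cases hb : b = 0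
        · exact ⟨.inl 0, by simp [f, ha, hb]⟩
        · exact ⟨.inr (.inr (e2.symm ⟨b, hb⟩)), by simp [f, ha]⟩
      · have hb : b = 0 := h'.resolve_left ha
        exact ⟨.inr (.inl (e1.symm ⟨a, ha⟩)), by simp [f, hb]⟩
    refine ⟨RelIso.symm ⟨Equiv.ofBijective f ⟨inj, surj⟩, ?_⟩⟩
    intro s t
    rw [uirg_adj]
    change (f s ≠ f t ∧ (((f s).1.1 = 0 ∧ (f t).1.1 = 0) ∨ ((f s).1.2 = 0 ∧ (f t).1.2 = 0))) ↔ _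
    rw [inj.ne_iff]
    rcases s with (i | i | i) <;> rcases t with (j | j | j) <;>
      simp [f, SimpleGraph.join, n1, n2]
end

section
/- Let R be a finite local commutative ring with unity, with maximal ideal M. Then the upper ideal relation graph Γ_U(R) is a complete graph (that is, any two distinct non-unit elements of R are adjacent) if and only if M is a principal ideal. -/
theorem upperIdealRelGraph_complete_iff_maximalIdeal_isPrincipal (R : Type*) [CommRing R]
    [Fintype R] [IsLocalRing R] :
    (∀ x y : {x : R // ¬ IsUnit x}, x ≠ y → (upperIdealRelGraph R).Adj x y) ↔
      (IsLocalRing.maximalIdeal R).IsPrincipal := by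
  classical
  constructor
  · intro h
    have pair : ∀ a b : R, ¬ IsUnit a → ¬ IsUnit b → ∃ z : R, ¬ IsUnit z ∧ z ∣ a ∧ z ∣ b := by
      intro a b ha hb
      by_cases hab : a = b
      · subst hab
        exact ⟨a, ha, dvd_rfl, dvd_rfl⟩
      · obtain ⟨-, z, hz, h1, h2⟩ := h ⟨a, ha⟩ ⟨b, hb⟩ (fun e => hab (congrArg Subtype.val e))
        exact ⟨z, hz, Ideal.span_singleton_le_span_singleton.mp h1,
          Ideal.span_singleton_le_span_singleton.mp h2⟩
    have key : ∀ s : Finset R, (∀ a ∈ s, ¬ IsUnit a) → ∃ z : R, ¬ IsUnit z ∧ ∀ a ∈ s, z ∣ a := by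
      intro s
      induction s using Finset.induction_on with
      | empty => exact fun _ => ⟨0, not_isUnit_zero, by simp⟩
      | insert a s has ih =>
        intro hs
        obtain ⟨w, hw, hws⟩ := ih (fun b hb => hs b (Finset.mem_insert_of_mem hb))
        obtain ⟨z, hz, hza, hzw⟩ := pair a w (hs a (Finset.mem_insert_self a s)) hw
        refine ⟨z, hz, fun b hb => ?_⟩
        rcases Finset.mem_insert.mp hb with rfl | hb
        · exact hza
        · exact hzw.trans (hws b hb)
    obtain ⟨z, hz, hzd⟩ := key (Finset.univ.filter fun a : R => ¬ IsUnit a) (by simp)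
    refine ⟨⟨z, ?_⟩⟩
    apply le_antisymm
    · intro a ha
      exact Ideal.mem_span_singleton.mpr (hzd a (by simpa using ha))
    · exact (Ideal.span_singleton_le_iff_mem _).mpr ((IsLocalRing.mem_maximalIdeal z).mpr hz)
  · rintro ⟨⟨z, hz⟩⟩ x y hxy
    have hz' : IsLocalRing.maximalIdeal R = Ideal.span {z} := hz
    have hle : ∀ a : R, ¬ IsUnit a → Ideal.span {a} ≤ Ideal.span {z} := by
      intro a ha
      rw [← hz', Ideal.span_singleton_le_iff_mem]
      exact (IsLocalRing.mem_maximalIdeal a).mpr ha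
    refine ⟨hxy, z, ?_, hle x x.2, hle y y.2⟩
    have : z ∈ IsLocalRing.maximalIdeal R := hz' ▸ Ideal.mem_span_singleton_self z
    exact (IsLocalRing.mem_maximalIdeal z).mp this
end

section
/- Let R ≅ R1 × R2 × ⋯ × Rn be a product of n ≥ 4 nontrivial finite local commutative rings with unity. Then the upper ideal relation graph Γ_U(R) contains a clique of size 5, i.e., there exist five distinct non-unit elements of R that are pairwise adjacent in Γ_U(R). -/
theorem upperIdealRelGraph_clique_5 {n : ℕ} (hn : 4 ≤ n) (Rs : Fin n → Type*)
    [∀ i, CommRing (Rs i)] [∀ i, Fintype (Rs i)] [∀ i, IsLocalRing (Rs i)] :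
    ∃ s : Finset {x : ∀ i, Rs i // ¬ IsUnit x},
      (upperIdealRelGraph (∀ i, Rs i)).IsNClique 5 s := by
  have hnu : ∀ x : (∀ i, Rs i), x ⟨0, by omega⟩ = 0 → ¬ IsUnit x := by
    intro x hx hu
    have h := hu.map (Pi.evalRingHom Rs ⟨0, by omega⟩)
    simp only [Pi.evalRingHom_apply, hx] at h
    exact not_isUnit_zero h
  let z : ∀ i, Rs i := fun i => if i.val = 0 then 0 else 1
  let g : Fin 5 → ∀ i, Rs i := fun k i =>
    if i.val = 0 then 0 else if k.val.testBit (i.val - 1) = true then 1 else 0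
  let f : Fin 5 → {x : ∀ i, Rs i // ¬ IsUnit x} := fun k => ⟨g k, hnu _ (by simp [g])⟩
  have hf : Function.Injective f := by
    intro a b hab
    have hg : g a = g b := congrArg Subtype.val hab
    have key : ∀ j : Fin 3, a.val.testBit j.val = b.val.testBit j.val := by
      intro j
      have h := congrFun hg ⟨j.val + 1, by omega⟩
      simp only [g] at h
      rw [if_neg (by omega)] at h
      simp only [Nat.add_sub_cancel] at h
      cases ha : a.val.testBit j.val <;> cases hb : b.val.testBit j.val <;>
        simp [ha, hb] at h ⊢
    clear hg hab
    revert a b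
    decide
  have hle : ∀ k, Ideal.span {g k} ≤ Ideal.span {z} := by
    intro k
    rw [Ideal.span_singleton_le_span_singleton]
    refine ⟨g k, ?_⟩
    funext i
    by_cases hi : i.val = 0 <;> simp [g, z, hi]
  refine ⟨Finset.univ.map ⟨f, hf⟩, ?_, by simp⟩
  intro x hx y hy hxy
  simp only [Finset.coe_map, Function.Embedding.coeFn_mk, Finset.coe_univ, Set.image_univ,
    Set.mem_range] at hx hy
  obtain ⟨a, rfl⟩ := hx
  obtain ⟨b, rfl⟩ := hy
  exact ⟨hxy, z, hnu _ (by simp [z]), hle a, hle b⟩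
end

section
/- Let R ≅ R1 × R2 × ⋯ × Rn be a product of n ≥ 3 nontrivial finite local commutative rings with unity. Then the upper ideal relation graph Γ_U(R) contains an induced path on four vertices; explicitly, the vertices a = (1,0,1,…,1), b = (1,0,0,…,0), c = (0,1,0,…,0), d = (0,1,1,…,1) satisfy: a~b, b~c, c~d are edges of Γ_U(R), while a~c, a~d, b~d are non-edges. In particular, Γ_U(R) is not a cograph. -/
theorem upperAdj_iff {R : Type*} [CommRing R] (x y : {x : R // ¬ IsUnit x}) :
    (upperIdealRelGraph R).Adj x y ↔ x ≠ y ∧ ∃ z : R, ¬ IsUnit z ∧ z ∣ x.1 ∧ z ∣ y.1 := by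
  simp only [upperIdealRelGraph, Ideal.span_singleton_le_span_singleton]

theorem pi_nonunit {ι : Type*} {Rs : ι → Type*} [∀ i, CommRing (Rs i)] [∀ i, Nontrivial (Rs i)]
    (x : ∀ i, Rs i) (i : ι) (h : x i = 0) : ¬ IsUnit x := by
  intro hx
  have := Pi.isUnit_iff.1 hx i
  rw [h] at this
  exact not_isUnit_zero this

theorem pi_nonadj {ι : Type*} {Rs : ι → Type*} [∀ i, CommRing (Rs i)]
    (x y : {x : ∀ i, Rs i // ¬ IsUnit x}) (h : ∀ i, x.1 i = 1 ∨ y.1 i = 1) :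
    ¬ (upperIdealRelGraph (∀ i, Rs i)).Adj x y := by
  rw [upperAdj_iff]
  rintro ⟨-, z, hz, ⟨u, hu⟩, ⟨v, hv⟩⟩
  apply hz
  rw [Pi.isUnit_iff]
  intro i
  rcases h i with h | h
  · rw [hu] at h
    exact IsUnit.of_mul_eq_one _ h
  · rw [hv] at h
    exact IsUnit.of_mul_eq_one _ h

theorem pi_adj {ι : Type*} {Rs : ι → Type*} [∀ i, CommRing (Rs i)] [∀ i, Nontrivial (Rs i)]
    (x y : {x : ∀ i, Rs i // ¬ IsUnit x}) (hxy : x.1 ≠ y.1) (i : ι)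
    (hx : x.1 i = 0) (hy : y.1 i = 0) :
    (upperIdealRelGraph (∀ i, Rs i)).Adj x y := by
  classical
  rw [upperAdj_iff]
  refine ⟨fun h => hxy (by rw [h]), fun j => if j = i then 0 else 1,
    pi_nonunit _ i (by simp), ⟨x.1, ?_⟩, ⟨y.1, ?_⟩⟩
  · funext j
    by_cases hj : j = i
    · subst hj; simp [hx]
    · simp [hj]
  · funext j
    by_cases hj : j = i
    · subst hj; simp [hy]
    · simp [hj]

theorem upperIdealRelGraph_inducedP4 {n : ℕ} (hn : 3 ≤ n) (Rs : Fin n → Type*)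
    [∀ i, CommRing (Rs i)] [∀ i, Fintype (Rs i)] [∀ i, IsLocalRing (Rs i)] :
    (∀ a b c d : ∀ i, Rs i,
      (a = fun i => if i = (⟨1, by omega⟩ : Fin n) then 0 else 1) →
      (b = fun i => if i = (⟨0, by omega⟩ : Fin n) then 1 else 0) →
      (c = fun i => if i = (⟨1, by omega⟩ : Fin n) then 1 else 0) →
      (d = fun i => if i = (⟨0, by omega⟩ : Fin n) then 0 else 1) →
      ∃ (ha : ¬ IsUnit a) (hb : ¬ IsUnit b) (hc : ¬ IsUnit c) (hd : ¬ IsUnit d),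
        a ≠ b ∧ a ≠ c ∧ a ≠ d ∧ b ≠ c ∧ b ≠ d ∧ c ≠ d ∧
        (upperIdealRelGraph (∀ i, Rs i)).Adj ⟨a, ha⟩ ⟨b, hb⟩ ∧
        (upperIdealRelGraph (∀ i, Rs i)).Adj ⟨b, hb⟩ ⟨c, hc⟩ ∧
        (upperIdealRelGraph (∀ i, Rs i)).Adj ⟨c, hc⟩ ⟨d, hd⟩ ∧
        ¬ (upperIdealRelGraph (∀ i, Rs i)).Adj ⟨a, ha⟩ ⟨c, hc⟩ ∧
        ¬ (upperIdealRelGraph (∀ i, Rs i)).Adj ⟨a, ha⟩ ⟨d, hd⟩ ∧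
        ¬ (upperIdealRelGraph (∀ i, Rs i)).Adj ⟨b, hb⟩ ⟨d, hd⟩) ∧
    ¬ (upperIdealRelGraph (∀ i, Rs i)).IsCograph := by
  have key : (∀ a b c d : ∀ i, Rs i,
      (a = fun i => if i = (⟨1, by omega⟩ : Fin n) then 0 else 1) →
      (b = fun i => if i = (⟨0, by omega⟩ : Fin n) then 1 else 0) →
      (c = fun i => if i = (⟨1, by omega⟩ : Fin n) then 1 else 0) →
      (d = fun i => if i = (⟨0, by omega⟩ : Fin n) then 0 else 1) →
      ∃ (ha : ¬ IsUnit a) (hb : ¬ IsUnit b) (hc : ¬ IsUnit c) (hd : ¬ IsUnit d),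
        a ≠ b ∧ a ≠ c ∧ a ≠ d ∧ b ≠ c ∧ b ≠ d ∧ c ≠ d ∧
        (upperIdealRelGraph (∀ i, Rs i)).Adj ⟨a, ha⟩ ⟨b, hb⟩ ∧
        (upperIdealRelGraph (∀ i, Rs i)).Adj ⟨b, hb⟩ ⟨c, hc⟩ ∧
        (upperIdealRelGraph (∀ i, Rs i)).Adj ⟨c, hc⟩ ⟨d, hd⟩ ∧
        ¬ (upperIdealRelGraph (∀ i, Rs i)).Adj ⟨a, ha⟩ ⟨c, hc⟩ ∧
        ¬ (upperIdealRelGraph (∀ i, Rs i)).Adj ⟨a, ha⟩ ⟨d, hd⟩ ∧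
        ¬ (upperIdealRelGraph (∀ i, Rs i)).Adj ⟨b, hb⟩ ⟨d, hd⟩) := by
    intro a b c d ea eb ec ed
    have a0 : a ⟨0, by omega⟩ = 1 := by simp [ea]
    have a1 : a ⟨1, by omega⟩ = 0 := by simp [ea]
    have a2 : a ⟨2, by omega⟩ = 1 := by simp [ea]
    have b0 : b ⟨0, by omega⟩ = 1 := by simp [eb]
    have b1 : b ⟨1, by omega⟩ = 0 := by simp [eb]
    have b2 : b ⟨2, by omega⟩ = 0 := by simp [eb]
    have c0 : c ⟨0, by omega⟩ = 0 := by simp [ec]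
    have c2 : c ⟨2, by omega⟩ = 0 := by simp [ec]
    have d0 : d ⟨0, by omega⟩ = 0 := by simp [ed]
    have d2 : d ⟨2, by omega⟩ = 1 := by simp [ed]
    have ne : ∀ (x y : ∀ i, Rs i) (i : Fin n), x i = 1 → y i = 0 → x ≠ y := by
      intro x y i hx hy h
      rw [h, hy] at hx
      exact zero_ne_one hx
    have hab := ne a b _ a2 b2
    have hbc := ne b c _ b0 c0
    have hcd := (ne d c _ d2 c2).symm
    refine ⟨pi_nonunit a _ a1, pi_nonunit b _ b1, pi_nonunit c _ c0, pi_nonunit d _ d0,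
      hab, ne a c _ a0 c0, ne a d _ a0 d0, hbc, ne b d _ b0 d0, hcd,
      pi_adj _ _ hab _ a1 b1, pi_adj _ _ hbc _ b2 c2, pi_adj _ _ hcd _ c0 d0,
      pi_nonadj _ _ ?_, pi_nonadj _ _ ?_, pi_nonadj _ _ ?_⟩
    · intro i
      by_cases h : i = (⟨1, by omega⟩ : Fin n) <;> simp [ea, ec, h]
    · intro i
      by_cases h : i = (⟨1, by omega⟩ : Fin n)
      · right; subst h; simp [ed]
      · left; simp [ea, h]
    · intro i
      by_cases h : i = (⟨0, by omega⟩ : Fin n) <;> simp [eb, ed, h]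
  refine ⟨key, fun hco => hco ?_⟩
  obtain ⟨ha, hb, hc, hd, h1, h2, h3, h4, h5, h6, h⟩ := key _ _ _ _ rfl rfl rfl rfl
  refine ⟨⟨_, ha⟩, ⟨_, hb⟩, ⟨_, hc⟩, ⟨_, hd⟩, ?_, ?_, ?_, ?_, ?_, ?_, h⟩
  · exact fun e => h1 (congrArg Subtype.val e)
  · exact fun e => h2 (congrArg Subtype.val e)
  · exact fun e => h3 (congrArg Subtype.val e)
  · exact fun e => h4 (congrArg Subtype.val e)
  · exact fun e => h5 (congrArg Subtype.val e)
  · exact fun e => h6 (congrArg Subtype.val e)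
end

section
/- Let R ≅ R1 × R2 × ⋯ × Rn be a product of n ≥ 4 nontrivial finite local commutative rings with unity. Then the upper ideal relation graph Γ_U(R) contains an induced 2K2; explicitly, the vertices u1 = (1,1,0,1,…,1), u2 = (0,1,0,1,…,1), v1 = (1,0,1,1,…,1), v2 = (1,0,1,0,1,…,1) satisfy: u1~u2 and v1~v2 are edges of Γ_U(R), and no other pair among these four vertices is adjacent. In particular, Γ_U(R) is not a split graph. -/
/-- A graph is a split graph if its vertex set can be partitioned into a clique and an
independent set. -/
def SimpleGraph.IsSplit {V : Type*} (G : SimpleGraph V) : Prop :=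
  ∃ A B : Set V, A ∪ B = Set.univ ∧ Disjoint A B ∧ G.IsClique A ∧
    ∀ x ∈ B, ∀ y ∈ B, ¬ G.Adj x y

theorem aux_nonunit {n : ℕ} (Rs : Fin n → Type*) [∀ i, CommRing (Rs i)]
    [∀ i, IsLocalRing (Rs i)] (x : ∀ i, Rs i) (i : Fin n) (h : x i = 0) : ¬ IsUnit x := by
  intro hx
  have := Pi.isUnit_iff.1 hx i
  rw [h] at this
  exact not_isUnit_zero this

theorem aux_nadj {n : ℕ} (Rs : Fin n → Type*) [∀ i, CommRing (Rs i)]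
    (x y : ∀ i, Rs i) (hx : ¬ IsUnit x) (hy : ¬ IsUnit y) (h : ∀ i, x i = 1 ∨ y i = 1) :
    ¬ (upperIdealRelGraph (∀ i, Rs i)).Adj ⟨x, hx⟩ ⟨y, hy⟩ := by
  rintro ⟨-, z, hz, h1, h2⟩
  rw [Ideal.span_singleton_le_span_singleton] at h1 h2
  apply hz
  rw [Pi.isUnit_iff]
  intro i
  obtain ⟨a, ha⟩ := h1
  obtain ⟨b, hb⟩ := h2
  have ha' := congrFun ha i
  have hb' := congrFun hb i
  simp only [Pi.mul_apply] at ha' hb'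
  rcases h i with h | h
  · exact IsUnit.of_mul_eq_one (a i) (by rw [← ha', h])
  · exact IsUnit.of_mul_eq_one (b i) (by rw [← hb', h])

theorem aux_adj {n : ℕ} (Rs : Fin n → Type*) [∀ i, CommRing (Rs i)]
    (x y : ∀ i, Rs i) (hx : ¬ IsUnit x) (hy : ¬ IsUnit y) (hne : x ≠ y) (h : y = x * y) :
    (upperIdealRelGraph (∀ i, Rs i)).Adj ⟨x, hx⟩ ⟨y, hy⟩ := by
  refine ⟨fun e => hne (congrArg Subtype.val e), x, hx, le_rfl, ?_⟩
  rw [Ideal.span_singleton_le_span_singleton]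
  exact ⟨y, h⟩

theorem aux_ne {n : ℕ} (Rs : Fin n → Type*) [∀ i, CommRing (Rs i)]
    [∀ i, IsLocalRing (Rs i)] (x y : ∀ i, Rs i) (i : Fin n)
    (h : (x i = 0 ∧ y i = 1) ∨ (x i = 1 ∧ y i = 0)) : x ≠ y := by
  rintro rfl
  rcases h with ⟨a, b⟩ | ⟨a, b⟩ <;> simp [a] at b

theorem upperIdealRelGraph_induced2K2 {n : ℕ} (hn : 4 ≤ n) (Rs : Fin n → Type*)
    [∀ i, CommRing (Rs i)] [∀ i, Fintype (Rs i)] [∀ i, IsLocalRing (Rs i)] :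
    (∀ u1 u2 v1 v2 : ∀ i, Rs i,
      (u1 = fun i => if i = (⟨2, by omega⟩ : Fin n) then 0 else 1) →
      (u2 = fun i => if i = (⟨0, by omega⟩ : Fin n) ∨ i = (⟨2, by omega⟩ : Fin n)
        then 0 else 1) →
      (v1 = fun i => if i = (⟨1, by omega⟩ : Fin n) then 0 else 1) →
      (v2 = fun i => if i = (⟨1, by omega⟩ : Fin n) ∨ i = (⟨3, by omega⟩ : Fin n)
        then 0 else 1) →
      ∃ (hu1 : ¬ IsUnit u1) (hu2 : ¬ IsUnit u2) (hv1 : ¬ IsUnit v1) (hv2 : ¬ IsUnit v2),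
        u1 ≠ u2 ∧ u1 ≠ v1 ∧ u1 ≠ v2 ∧ u2 ≠ v1 ∧ u2 ≠ v2 ∧ v1 ≠ v2 ∧
        (upperIdealRelGraph (∀ i, Rs i)).Adj ⟨u1, hu1⟩ ⟨u2, hu2⟩ ∧
        (upperIdealRelGraph (∀ i, Rs i)).Adj ⟨v1, hv1⟩ ⟨v2, hv2⟩ ∧
        ¬ (upperIdealRelGraph (∀ i, Rs i)).Adj ⟨u1, hu1⟩ ⟨v1, hv1⟩ ∧
        ¬ (upperIdealRelGraph (∀ i, Rs i)).Adj ⟨u1, hu1⟩ ⟨v2, hv2⟩ ∧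
        ¬ (upperIdealRelGraph (∀ i, Rs i)).Adj ⟨u2, hu2⟩ ⟨v1, hv1⟩ ∧
        ¬ (upperIdealRelGraph (∀ i, Rs i)).Adj ⟨u2, hu2⟩ ⟨v2, hv2⟩) ∧
    ¬ (upperIdealRelGraph (∀ i, Rs i)).IsSplit := by
  refine and_iff_left_of_imp ?_ |>.2 ?_
  rotate_left
  · rintro u1 u2 v1 v2 h1 h2 h3 h4
    have n1 : u1 ≠ u2 := aux_ne Rs _ _ ⟨0, by omega⟩ (by simp [h1, h2])
    have n6 : v1 ≠ v2 := aux_ne Rs _ _ ⟨3, by omega⟩ (by simp [h3, h4])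
    refine ⟨aux_nonunit Rs _ ⟨2, by omega⟩ (by simp [h1]),
      aux_nonunit Rs _ ⟨2, by omega⟩ (by simp [h2]),
      aux_nonunit Rs _ ⟨1, by omega⟩ (by simp [h3]),
      aux_nonunit Rs _ ⟨1, by omega⟩ (by simp [h4]), n1,
      aux_ne Rs _ _ ⟨2, by omega⟩ (by simp [h1, h3]),
      aux_ne Rs _ _ ⟨2, by omega⟩ (by simp [h1, h4]),
      aux_ne Rs _ _ ⟨2, by omega⟩ (by simp [h2, h3]),
      aux_ne Rs _ _ ⟨2, by omega⟩ (by simp [h2, h4]), n6,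
      aux_adj Rs _ _ _ _ n1 ?_, aux_adj Rs _ _ _ _ n6 ?_,
      aux_nadj Rs _ _ _ _ ?_, aux_nadj Rs _ _ _ _ ?_,
      aux_nadj Rs _ _ _ _ ?_, aux_nadj Rs _ _ _ _ ?_⟩
    · funext i
      simp only [h1, h2, Pi.mul_apply]
      split_ifs <;> simp_all
    · funext i
      simp only [h3, h4, Pi.mul_apply]
      split_ifs <;> simp_all
    all_goals
      intro i
      simp only [h1, h2, h3, h4]
      split_ifs <;> simp_all [Fin.ext_iff] <;> omega
  · rintro H ⟨A, B, hAB, -, hA, hB⟩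
    obtain ⟨hu1, hu2, hv1, hv2, -, n2, n3, n4, n5, -, e1, e2, f1, f2, f3, f4⟩ :=
      H _ _ _ _ rfl rfl rfl rfl
    have key : ∀ x y, (upperIdealRelGraph (∀ i, Rs i)).Adj x y → x ∈ A ∨ y ∈ A := by
      intro x y hxy
      by_contra! hc
      have mem : ∀ z, z ∈ A ∨ z ∈ B := fun z => by
        have : z ∈ A ∪ B := hAB ▸ Set.mem_univ z
        exact this
      exact hB x ((mem x).resolve_left hc.1) y ((mem y).resolve_left hc.2) hxy
    rcases key _ _ e1 with a | a <;> rcases key _ _ e2 with b | b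
    · exact f1 (hA a b fun e => n2 (congrArg Subtype.val e))
    · exact f2 (hA a b fun e => n3 (congrArg Subtype.val e))
    · exact f3 (hA a b fun e => n4 (congrArg Subtype.val e))
    · exact f4 (hA a b fun e => n5 (congrArg Subtype.val e))
end

section
/- Let (R1, M1) be a finite local commutative ring with unity whose maximal ideal M1 is NOT a principal ideal, and let R2 be a nontrivial commutative ring with unity. Then R1 has at least two distinct maximal principal ideals (x1) and (x2), the generators x1 and x2 are non-adjacent in Γ_U(R1), and in Γ_U(R1 × R2) the vertices (x1,1), (x1,0), (x2,0), (x2,1) form an induced path P4 (with edges exactly (x1,1)~(x1,0), (x1,0)~(x2,0), (x2,0)~(x2,1)). -/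
/-- An ideal is a maximal principal ideal if it is maximal among all proper principal
ideals. -/
def Ideal.IsMaximalPrincipal {R : Type*} [CommRing R] (I : Ideal R) : Prop :=
  I.IsPrincipal ∧ I ≠ ⊤ ∧ ∀ J : Ideal R, J.IsPrincipal → J ≠ ⊤ → I ≤ J → I = J

theorem exists_maxPrincipal_above {R : Type*} [CommRing R] [Finite R] (a : R) (ha : ¬ IsUnit a) :
    ∃ x : R, a ∈ Ideal.span {x} ∧ (Ideal.span {x}).IsMaximalPrincipal := by
  have hfin : ({I : Ideal R | I.IsPrincipal ∧ I ≠ ⊤ ∧ a ∈ I}).Finite := Set.toFinite _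
  have hne : ({I : Ideal R | I.IsPrincipal ∧ I ≠ ⊤ ∧ a ∈ I}).Nonempty :=
    ⟨Ideal.span {a}, ⟨a, rfl⟩, fun h => ha (Ideal.span_singleton_eq_top.1 h),
      Ideal.mem_span_singleton_self a⟩
  obtain ⟨I, ⟨hp, ht, hm⟩, hmax⟩ := hfin.exists_maximal hne
  obtain ⟨x, rfl⟩ := hp
  refine ⟨x, hm, ⟨x, rfl⟩, ht, fun J hJ hJt hle => ?_⟩
  exact le_antisymm hle (hmax ⟨hJ, hJt, hle hm⟩ hle)

theorem upperIdealRelGraph_nonprincipal_inducedP4 (R1 R2 : Type*) [CommRing R1] [Fintype R1]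
    [IsLocalRing R1] (hM : ¬ (IsLocalRing.maximalIdeal R1).IsPrincipal)
    [CommRing R2] [Nontrivial R2] :
    ∃ x1 x2 : R1,
      Ideal.span {x1} ≠ Ideal.span {x2} ∧
      (Ideal.span {x1}).IsMaximalPrincipal ∧ (Ideal.span {x2}).IsMaximalPrincipal ∧
      (∃ (h1 : ¬ IsUnit x1) (h2 : ¬ IsUnit x2),
        ¬ (upperIdealRelGraph R1).Adj ⟨x1, h1⟩ ⟨x2, h2⟩) ∧
      (∃ (pa : ¬ IsUnit ((x1, 1) : R1 × R2)) (pb : ¬ IsUnit ((x1, 0) : R1 × R2))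
         (pc : ¬ IsUnit ((x2, 0) : R1 × R2)) (pd : ¬ IsUnit ((x2, 1) : R1 × R2)),
        ((x1, 1) : R1 × R2) ≠ (x1, 0) ∧ ((x1, 1) : R1 × R2) ≠ (x2, 0) ∧
        ((x1, 1) : R1 × R2) ≠ (x2, 1) ∧ ((x1, 0) : R1 × R2) ≠ (x2, 0) ∧
        ((x1, 0) : R1 × R2) ≠ (x2, 1) ∧ ((x2, 0) : R1 × R2) ≠ (x2, 1) ∧
        (upperIdealRelGraph (R1 × R2)).Adj ⟨(x1, 1), pa⟩ ⟨(x1, 0), pb⟩ ∧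
        (upperIdealRelGraph (R1 × R2)).Adj ⟨(x1, 0), pb⟩ ⟨(x2, 0), pc⟩ ∧
        (upperIdealRelGraph (R1 × R2)).Adj ⟨(x2, 0), pc⟩ ⟨(x2, 1), pd⟩ ∧
        ¬ (upperIdealRelGraph (R1 × R2)).Adj ⟨(x1, 1), pa⟩ ⟨(x2, 0), pc⟩ ∧
        ¬ (upperIdealRelGraph (R1 × R2)).Adj ⟨(x1, 1), pa⟩ ⟨(x2, 1), pd⟩ ∧
        ¬ (upperIdealRelGraph (R1 × R2)).Adj ⟨(x1, 0), pb⟩ ⟨(x2, 1), pd⟩) := by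
  obtain ⟨x1, -, hx1⟩ := exists_maxPrincipal_above (0 : R1) not_isUnit_zero
  have hu1 : ¬ IsUnit x1 := fun h => hx1.2.1 (Ideal.span_singleton_eq_top.2 h)
  have hex : ∃ a : R1, ¬ IsUnit a ∧ a ∉ Ideal.span {x1} := by
    by_contra hcon
    push Not at hcon
    apply hM
    refine ⟨x1, le_antisymm (fun a ha => hcon a ?_) ?_⟩
    · exact (IsLocalRing.mem_maximalIdeal a).1 ha
    · exact (Ideal.span_singleton_le_iff_mem _).2 ((IsLocalRing.mem_maximalIdeal x1).2 hu1)
  obtain ⟨a, ha, hax⟩ := hex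
  obtain ⟨x2, hax2, hx2⟩ := exists_maxPrincipal_above a ha
  have hu2 : ¬ IsUnit x2 := fun h => hx2.2.1 (Ideal.span_singleton_eq_top.2 h)
  have hne : Ideal.span {x1} ≠ Ideal.span {x2} := fun h => hax (h ▸ hax2)
  have hxne : x1 ≠ x2 := fun h => hne (by rw [h])
  have key : ∀ z : R1, ¬ IsUnit z → z ∣ x1 → z ∣ x2 → False := by
    intro z hz h1 h2
    have ht : Ideal.span {z} ≠ ⊤ := fun h => hz (Ideal.span_singleton_eq_top.1 h)
    exact hne ((hx1.2.2 _ ⟨z, rfl⟩ ht (Ideal.span_singleton_le_span_singleton.2 h1)).trans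
      (hx2.2.2 _ ⟨z, rfl⟩ ht (Ideal.span_singleton_le_span_singleton.2 h2)).symm)
  have key2 : ∀ (z : R1 × R2) (b c : R2), ¬ IsUnit z → (b = 1 ∨ c = 1) →
      z ∣ (x1, b) → z ∣ (x2, c) → False := by
    rintro ⟨z1, z2⟩ b c hz hbc ⟨⟨u1, u2⟩, hu⟩ ⟨⟨v1, v2⟩, hv⟩
    simp only [Prod.mk_mul_mk, Prod.mk.injEq] at hu hv
    have hz2 : IsUnit z2 := by
      rcases hbc with rfl | rfl
      · exact IsUnit.of_mul_eq_one _ hu.2.symm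
      · exact IsUnit.of_mul_eq_one _ hv.2.symm
    exact key z1 (fun h => hz (Prod.isUnit_iff.2 ⟨h, hz2⟩)) ⟨u1, hu.1⟩ ⟨v1, hv.1⟩
  have hs : ∀ x y : R1 × R2, Ideal.span {x} ≤ Ideal.span {y} ↔ y ∣ x := fun x y =>
    Ideal.span_singleton_le_span_singleton
  have n1 : ∀ b : R2, ¬ IsUnit ((x1, b) : R1 × R2) := fun b h => hu1 (Prod.isUnit_iff.1 h).1
  have n2 : ∀ b : R2, ¬ IsUnit ((x2, b) : R1 × R2) := fun b h => hu2 (Prod.isUnit_iff.1 h).1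
  have n3 : ¬ IsUnit ((1, 0) : R1 × R2) := fun h => not_isUnit_zero (Prod.isUnit_iff.1 h).2
  have d : ∀ x : R1, ((x, 1) : R1 × R2) ∣ (x, 0) := fun x => ⟨(1, 0), by simp⟩
  have e : ∀ x : R1, ((1, 0) : R1 × R2) ∣ (x, 0) := fun x => ⟨(x, 0), by simp⟩
  refine ⟨x1, x2, hne, hx1, hx2, ⟨hu1, hu2, ?_⟩, n1 1, n1 0, n2 0, n2 1, by simp, by simp,
    by simp [hxne], by simp [hxne], by simp, by simp, ?_, ?_, ?_, ?_, ?_, ?_⟩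
  · rintro ⟨-, z, hz, h1, h2⟩
    exact key z hz (Ideal.span_singleton_le_span_singleton.1 h1)
      (Ideal.span_singleton_le_span_singleton.1 h2)
  · exact ⟨by simp, (x1, 1), n1 1, le_rfl, (hs _ _).2 (d x1)⟩
  · exact ⟨by simp [hxne], (1, 0), n3, (hs _ _).2 (e x1), (hs _ _).2 (e x2)⟩
  · exact ⟨by simp, (x2, 1), n2 1, (hs _ _).2 (d x2), le_rfl⟩
  · rintro ⟨-, z, hz, h1, h2⟩
    exact key2 z 1 0 hz (Or.inl rfl) ((hs _ _).1 h1) ((hs _ _).1 h2)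
  · rintro ⟨-, z, hz, h1, h2⟩
    exact key2 z 1 1 hz (Or.inl rfl) ((hs _ _).1 h1) ((hs _ _).1 h2)
  · rintro ⟨-, z, hz, h1, h2⟩
    exact key2 z 0 1 hz (Or.inr rfl) ((hs _ _).1 h1) ((hs _ _).1 h2)
end
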